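/- arXiv:math/0604022 — 3 statements merged into one kernel-verified Lean document; each statement's English description precedes it below -/
import Mathlib

section
/- Let r > 0 and let χ : ℝ → ℝ be a convex continuous function such that χ(x) = |x| whenever |x| > r. Then for every x ∈ ℝ, χ(x) = sup{k·x + l : k, l ∈ ℝ, |k| ≤ 1, and k·t + l ≤ χ(t) for all t ∈ ℝ}; i.e., χ is the upper envelope of its affine minorants of slope at most 1 in absolute value. -/
/-- An affine function lying below the identity on a half-line `(r, ∞)` has slope at most `1`. -/
lemma slope_le_one_of_affine_le_id {k l r : ℝ} (h : ∀ t : ℝ, r < t → k * t + l ≤ t) : k ≤ 1 := by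
  by_contra! hk
  have hk' : 0 < k - 1 := sub_pos.2 hk
  have hr : r < max (r + 1) ((1 - l) / (k - 1)) := (lt_add_one r).trans_le (le_max_left _ _)
  have hl := (div_le_iff₀ hk').1 (le_max_right (r + 1) ((1 - l) / (k - 1)))
  linarith [h _ hr]

/-- An affine function lying below `|·|` outside `[-r, r]` has slope at most `1` in absolute
value. -/
lemma abs_slope_le_one_of_affine_le_abs {k l r : ℝ} (hr : 0 < r)
    (h : ∀ t : ℝ, r < |t| → k * t + l ≤ |t|) : |k| ≤ 1 := by
  refine abs_le'.2 ⟨slope_le_one_of_affine_le_id (l := l) (r := r) fun t ht ↦ ?_,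
    slope_le_one_of_affine_le_id (l := l) (r := r) fun t ht ↦ ?_⟩
  · have habs : |t| = t := abs_of_pos (hr.trans ht)
    simpa [habs] using h t (by rwa [habs])
  · have habs : |-t| = t := by rw [abs_neg, abs_of_pos (hr.trans ht)]
    simpa [habs] using h (-t) (by rwa [habs])

/-- A convex continuous function `χ` that agrees with `|·|` outside `[-r, r]` is the upper
envelope of its affine minorants of slope at most `1` in absolute value. -/
theorem chi_eq_sup_affine_minorants (r : ℝ) (hr : 0 < r) (χ : ℝ → ℝ)
    (hconv : ConvexOn ℝ Set.univ χ) (hcont : Continuous χ)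
    (hχ : ∀ x : ℝ, r < |x| → χ x = |x|) :
    ∀ x : ℝ, χ x =
      sSup {y : ℝ | ∃ k l : ℝ, |k| ≤ 1 ∧ (∀ t : ℝ, k * t + l ≤ χ t) ∧ y = k * x + l} := by
  intro x
  have approx : ∀ a < χ x, ∃ y ∈ {y : ℝ | ∃ k l : ℝ, |k| ≤ 1 ∧ (∀ t : ℝ, k * t + l ≤ χ t) ∧
      y = k * x + l}, a < y := by
    intro a ha
    obtain ⟨b, hab, hb⟩ := exists_between ha
    obtain ⟨k, l, hle, heq⟩ := hconv.exists_affine_le_of_lt_real (Set.mem_univ x) hb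
      isClosed_univ (hcont.lowerSemicontinuous.lowerSemicontinuousOn _)
    have hmin : ∀ t : ℝ, k * t + l ≤ χ t := fun t ↦ hle t (Set.mem_univ t)
    exact ⟨k * x + l, ⟨k, l, abs_slope_le_one_of_affine_le_abs hr fun t ht ↦
      hχ t ht ▸ hmin t, hmin, rfl⟩, by linarith⟩
  symm
  refine csSup_eq_of_forall_le_of_forall_lt_exists_gt ?_ ?_ approx
  · obtain ⟨y, hy, -⟩ := approx (χ x - 1) (sub_one_lt _)
    exact ⟨y, hy⟩
  · rintro _ ⟨k, l, -, hmin, rfl⟩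
    exact hmin x
end

section
/- Let r > 0 and let χ : ℝ → ℝ be a convex function such that χ(x) = |x| whenever |x| > r. Let U be a set, let u₁, u₂ : U → ℝ, and define M_r(u₁,u₂)(z) = (χ(u₁(z) − u₂(z)) + u₁(z) + u₂(z))/2. Then M_r(u₁,u₂)(z) ≥ max(u₁(z), u₂(z)) for all z ∈ U, and M_r(u₁,u₂)(z) = max(u₁(z), u₂(z)) for every z with |u₁(z) − u₂(z)| > r. -/
/-- A convex function on `ℝ` that agrees with the identity near `+∞` dominates the identity. -/
theorem ConvexOn.self_le_of_eq_self_of_lt {χ : ℝ → ℝ} {r : ℝ} (hconv : ConvexOn ℝ Set.univ χ)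
    (hχ : ∀ x, r < x → χ x = x) (x : ℝ) : x ≤ χ x := by
  obtain ⟨y, hy⟩ := exists_gt (max r x)
  obtain ⟨hry, hxy⟩ := max_lt_iff.1 hy
  have hmid := hconv.2 (Set.mem_univ x) (Set.mem_univ (2 * y - x))
    (by norm_num : (0 : ℝ) ≤ 1 / 2) (by norm_num : (0 : ℝ) ≤ 1 / 2) (by norm_num)
  simp only [smul_eq_mul] at hmid
  rw [show 1 / 2 * x + 1 / 2 * (2 * y - x) = y by ring, hχ y hry,
    hχ (2 * y - x) (by linarith)] at hmid
  linarith

/-- A convex function on `ℝ` that agrees with the absolute value outside a bounded interval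
dominates the absolute value. -/
theorem ConvexOn.abs_le_of_eq_abs_of_lt_abs {χ : ℝ → ℝ} {r : ℝ} (hr : 0 ≤ r)
    (hconv : ConvexOn ℝ Set.univ χ) (hχ : ∀ x, r < |x| → χ x = |x|) (x : ℝ) : |x| ≤ χ x := by
  refine abs_le'.2 ⟨hconv.self_le_of_eq_self_of_lt (r := r) (fun y hy => ?_) x, ?_⟩
  · have habs : |y| = y := abs_of_pos (hr.trans_lt hy)
    rw [hχ y (habs.symm ▸ hy), habs]
  · have hneg : ConvexOn ℝ Set.univ (fun y => χ (-y)) :=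
      hconv.comp_linearMap (-LinearMap.id)
    have hle := hneg.self_le_of_eq_self_of_lt (r := r) (fun y hy => ?_) (-x)
    · simpa using hle
    · have habs : |-y| = y := by rw [abs_neg, abs_of_pos (hr.trans_lt hy)]
      rw [hχ (-y) (habs.symm ▸ hy), habs]

/-- The regularized maximum `M_r(u₁,u₂) = (χ(u₁ - u₂) + u₁ + u₂)/2` dominates
`max(u₁, u₂)` and agrees with it wherever `|u₁ - u₂| > r`. -/
theorem regularized_max_ge_max {U : Type*} (r : ℝ) (hr : 0 < r) (χ : ℝ → ℝ)
    (hconv : ConvexOn ℝ Set.univ χ)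
    (hχ : ∀ x : ℝ, r < |x| → χ x = |x|)
    (u₁ u₂ : U → ℝ) :
    (∀ z : U, max (u₁ z) (u₂ z) ≤ (χ (u₁ z - u₂ z) + u₁ z + u₂ z) / 2) ∧
    (∀ z : U, r < |u₁ z - u₂ z| →
      (χ (u₁ z - u₂ z) + u₁ z + u₂ z) / 2 = max (u₁ z) (u₂ z)) := by
  have hmax (a b : ℝ) : max a b = (|a - b| + a + b) / 2 := by
    rcases le_total a b with h | h
    · rw [max_eq_right h, abs_of_nonpos (sub_nonpos.2 h)]
      ring
    · rw [max_eq_left h, abs_of_nonneg (sub_nonneg.2 h)]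
      ring
  refine ⟨fun z => ?_, fun z hz => ?_⟩
  · rw [hmax]
    linarith [hconv.abs_le_of_eq_abs_of_lt_abs hr.le hχ (u₁ z - u₂ z)]
  · rw [hmax, hχ _ hz]
end

section
/- Let r > 0 and let χ : ℝ → ℝ be a convex continuous function such that χ(x) = |x| whenever |x| > r. Then for all a, b ∈ ℝ, χ(a − b) + a + b = sup{(1 + k)·a + (1 − k)·b + l : k, l ∈ ℝ, |k| ≤ 1, and k·t + l ≤ χ(t) for all t ∈ ℝ}. -/
theorem slope_le_of_affine_le_eventually {k l m r : ℝ}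
    (h : ∀ t, r < t → k * t + l ≤ m * t) : k ≤ m := by
  by_contra! hmk
  have hpos : 0 < k - m := sub_pos.2 hmk
  obtain ⟨t, ht⟩ := exists_gt (max r (-l / (k - m)))
  have hlt := (div_lt_iff₀ hpos).1 ((le_max_right _ _).trans_lt ht)
  linarith [h t ((le_max_left _ _).trans_lt ht)]

theorem abs_slope_le_one_of_affine_le {χ : ℝ → ℝ} {k l r : ℝ}
    (hχ : ∀ x : ℝ, r < |x| → χ x = |x|) (h : ∀ t, k * t + l ≤ χ t) : |k| ≤ 1 := by
  have hbound (t : ℝ) (ht : r < |t|) : k * t + l ≤ |t| := (h t).trans_eq (hχ t ht)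
  refine abs_le'.2 ⟨slope_le_of_affine_le_eventually (l := l) (r := max r 0) fun t ht ↦ ?_,
    slope_le_of_affine_le_eventually (l := l) (r := max r 0) fun t ht ↦ ?_⟩
  all_goals
    obtain ⟨hrt, ht0⟩ := max_lt_iff.1 ht
  · simpa [abs_of_pos ht0] using hbound t (by rwa [abs_of_pos ht0])
  · simpa [abs_of_pos ht0] using hbound (-t) (by rwa [abs_neg, abs_of_pos ht0])

/-- The envelope identity for the regularized maximum:
`χ(a - b) + a + b = sup {(1+k)a + (1-k)b + l}` over affine minorants `k·t + l ≤ χ(t)`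
with `|k| ≤ 1`. -/
theorem regularized_max_envelope (r : ℝ) (hr : 0 < r) (χ : ℝ → ℝ)
    (hconv : ConvexOn ℝ Set.univ χ) (hcont : Continuous χ)
    (hχ : ∀ x : ℝ, r < |x| → χ x = |x|) :
    ∀ a b : ℝ, χ (a - b) + a + b =
      sSup {y : ℝ | ∃ k l : ℝ, |k| ≤ 1 ∧ (∀ t : ℝ, k * t + l ≤ χ t) ∧
        y = (1 + k) * a + (1 - k) * b + l} := by
  intro a b
  have exists_minorant (c : ℝ) (hc : c < χ (a - b)) :
      ∃ k l : ℝ, |k| ≤ 1 ∧ (∀ t, k * t + l ≤ χ t) ∧ c + a + b = (1 + k) * a + (1 - k) * b + l := by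
    obtain ⟨k, l, hle, heq⟩ := hconv.exists_affine_le_of_lt_real (Set.mem_univ _) hc
      isClosed_univ (hcont.lowerSemicontinuous.lowerSemicontinuousOn _)
    have hle' (t : ℝ) : k * t + l ≤ χ t := hle t (Set.mem_univ t)
    exact ⟨k, l, abs_slope_le_one_of_affine_le hχ hle', hle', by linarith⟩
  symm
  refine csSup_eq_of_forall_le_of_forall_lt_exists_gt
    ⟨_, exists_minorant _ (sub_one_lt _)⟩ ?_ fun w hw ↦ ?_
  · rintro _ ⟨k, l, -, hle, rfl⟩
    linarith [hle (a - b)]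
  · obtain ⟨y, hwy, hy⟩ := exists_between hw
    exact ⟨_, exists_minorant (y - a - b) (by linarith), by linarith⟩
end
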